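/- Define, for λ > 0 and x ≠ y in ℝ², E₀^±(λ)(x,y) := ±(i/4) H₀^±(λ|x−y|) − ( ±i/4 − (1/(2π)) log(λ/2) − γ/(2π) ) + (1/(2π)) log|x−y|. Then there is a constant C such that for all λ > 0 and all x ≠ y in ℝ²: |E₀^±(λ)(x,y)| ≤ C λ^{1/2} |x−y|^{1/2}, |∂_λ E₀^±(λ)(x,y)| ≤ C λ^{−1/2} |x−y|^{1/2}, and |∂_λ² E₀^±(λ)(x,y)| ≤ C λ^{−1/2} |x−y|^{3/2}. -/

import Mathlib

open MeasureTheory Real Set Filter Complex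

noncomputable section

/-- The plane `ℝ²`. -/
abbrev Plane : Type := EuclideanSpace ℝ (Fin 2)

/-- The Bessel function of the first kind of order zero,
`J₀(z) = (1/π) ∫₀^π cos(z sin θ) dθ`. -/
def J0 (z : ℝ) : ℝ := (1 / Real.pi) * ∫ θ in (0:ℝ)..Real.pi, Real.cos (z * Real.sin θ)

/-- The Bessel function of the second kind of order zero, defined for `z > 0` by the
(improper) integral `Y₀(z) = −(2/π) lim_{T→∞} ∫₀^T cos(z cosh t) dt`. -/
def Y0 (z : ℝ) : ℝ :=
  -(2 / Real.pi) * limUnder atTop (fun T : ℝ => ∫ t in (0:ℝ)..T, Real.cos (z * Real.cosh t))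

/-- The Hankel function of order zero `H₀^±(z) = J₀(z) ± iY₀(z)`; the sign `ε = ±1`. -/
def H0 (ε : ℝ) (z : ℝ) : ℂ := (J0 z : ℂ) + ε * Complex.I * (Y0 z : ℂ)

/-- The error term `E₀^±(λ)(x,y)` in the expansion of the free resolvent
`R₀^±(λ²)(x,y) = ±(i/4)H₀^±(λ|x−y|)` around zero energy:
`E₀^± = ±(i/4)H₀^±(λ|x−y|) − (±i/4 − (1/2π)log(λ/2) − γ/2π) + (1/2π)log|x−y|`. -/
def E0 (ε : ℝ) (l : ℝ) (x y : Plane) : ℂ :=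
  ε * (Complex.I / 4) * H0 ε (l * ‖x - y‖) -
    (ε * Complex.I / 4 - (1 / (2 * Real.pi)) * (Real.log (l / 2) : ℂ) -
      (Real.eulerMascheroniConstant / (2 * Real.pi) : ℝ)) +
    (1 / (2 * Real.pi)) * (Real.log ‖x - y‖ : ℂ)

/-- The Laplace-type integral `∫₀^∞ g(s) exp(-z sinh s) ds`. -/
def sinhLaplace (g : ℝ → ℝ) (z : ℝ) : ℝ := ∫ s in Ioi (0:ℝ), g s * Real.exp (-z * Real.sinh s)

theorem sq_div_two_le_sinh {s : ℝ} (hs : 0 ≤ s) : s ^ 2 / 2 ≤ Real.sinh s := by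
  have h1 : s / 2 ≤ Real.sinh (s / 2) := Real.self_le_sinh_iff.2 (by linarith)
  have h2 : s / 4 ≤ Real.sinh (s / 4) := Real.self_le_sinh_iff.2 (by linarith)
  have h3 : Real.sinh s = 2 * Real.sinh (s / 2) * Real.cosh (s / 2) := by
    rw [← Real.sinh_two_mul]; ring_nf
  have h4 : Real.cosh (s / 2) = 1 + 2 * Real.sinh (s / 4) ^ 2 := by
    have := Real.cosh_two_mul (s / 4)
    rw [Real.cosh_sq] at this
    rw [show s / 2 = 2 * (s / 4) by ring, this]; ring
  have h5 : 1 + s ^ 2 / 8 ≤ Real.cosh (s / 2) := by rw [h4]; nlinarith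
  have h6 : s / 2 * (1 + s ^ 2 / 8) ≤ Real.sinh (s / 2) * Real.cosh (s / 2) := by gcongr
  rw [h3]
  nlinarith [mul_nonneg hs (sq_nonneg (s - 2))]

theorem cosh_le_one_add_sinh {s : ℝ} (hs : 0 ≤ s) : Real.cosh s ≤ 1 + Real.sinh s := by
  have := Real.sinh_nonneg_iff.2 hs
  have := Real.cosh_sq s
  nlinarith [Real.cosh_pos s]

theorem exists_one_add_sinh_pow_mul_exp_le (k : ℕ) {z : ℝ} (hz : 0 < z) :
    ∃ C : ℝ, ∀ s : ℝ, 0 ≤ s →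
      (1 + Real.sinh s) ^ k * Real.exp (-z * Real.sinh s) ≤ C * Real.exp (-s) := by
  refine ⟨2 * ((k + 1).factorial * Real.exp z / z ^ (k + 1)), fun s hs => ?_⟩
  have hx := Real.sinh_nonneg_iff.2 hs
  have hexp : Real.exp s ≤ 2 * (1 + Real.sinh s) := by
    have := Real.cosh_add_sinh s
    have := cosh_le_one_add_sinh hs
    linarith
  have hpow := Real.pow_div_factorial_le_exp (x := z * (1 + Real.sinh s)) (by positivity) (k + 1)
  have hz' : 0 < z ^ (k + 1) := by positivity
  have hbd : (1 + Real.sinh s) ^ (k + 1) * Real.exp (-z * Real.sinh s) ≤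
      (k + 1).factorial * Real.exp z / z ^ (k + 1) := by
    rw [le_div_iff₀ hz', ← div_le_iff₀' (by positivity)]
    calc (1 + Real.sinh s) ^ (k + 1) * Real.exp (-z * Real.sinh s) * z ^ (k + 1) /
          (k + 1).factorial
        = ((z * (1 + Real.sinh s)) ^ (k + 1) / (k + 1).factorial) *
            Real.exp (-z * Real.sinh s) := by rw [mul_pow]; ring
      _ ≤ Real.exp (z * (1 + Real.sinh s)) * Real.exp (-z * Real.sinh s) := by gcongr
      _ = Real.exp z := by rw [← Real.exp_add]; ring_nf
  rw [Real.exp_neg s, ← div_eq_mul_inv, le_div_iff₀ (Real.exp_pos s)]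
  calc (1 + Real.sinh s) ^ k * Real.exp (-z * Real.sinh s) * Real.exp s
      ≤ (1 + Real.sinh s) ^ k * Real.exp (-z * Real.sinh s) * (2 * (1 + Real.sinh s)) := by gcongr
    _ = 2 * ((1 + Real.sinh s) ^ (k + 1) * Real.exp (-z * Real.sinh s)) := by ring
    _ ≤ _ := by gcongr

theorem integrableOn_one_add_sinh_pow_mul_exp (k : ℕ) {z : ℝ} (hz : 0 < z) :
    IntegrableOn (fun s => (1 + Real.sinh s) ^ k * Real.exp (-z * Real.sinh s)) (Ioi 0) := by
  obtain ⟨C, hC⟩ := exists_one_add_sinh_pow_mul_exp_le k hz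
  have hint : IntegrableOn (fun s => C * Real.exp (-s)) (Ioi 0) := by
    have := (exp_neg_integrableOn_Ioi 0 one_pos).const_mul C
    simpa [IntegrableOn] using this
  refine Integrable.mono' hint ?_ ?_
  · exact Continuous.aestronglyMeasurable (by fun_prop)
  · filter_upwards [ae_restrict_mem measurableSet_Ioi] with s hs
    have := Real.sinh_nonneg_iff.2 (le_of_lt hs)
    rw [Real.norm_of_nonneg (by positivity)]
    exact hC s (le_of_lt hs)

theorem integrableOn_mul_exp_sinh {g : ℝ → ℝ} (hg : Continuous g) (k : ℕ)
    (hgk : ∀ s, 0 ≤ s → |g s| ≤ (1 + Real.sinh s) ^ k) {z : ℝ} (hz : 0 < z) :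
    IntegrableOn (fun s => g s * Real.exp (-z * Real.sinh s)) (Ioi 0) := by
  refine Integrable.mono' (integrableOn_one_add_sinh_pow_mul_exp k hz) ?_ ?_
  · exact Continuous.aestronglyMeasurable (by fun_prop)
  · filter_upwards [ae_restrict_mem measurableSet_Ioi] with s hs
    rw [norm_mul, Real.norm_eq_abs, Real.norm_of_nonneg (Real.exp_pos _).le]
    gcongr
    exact hgk s (le_of_lt hs)

theorem hasDerivAt_sinhLaplace {g : ℝ → ℝ} (hg : Continuous g)
    (hg1 : ∀ s, 0 ≤ s → |g s| ≤ 1) {z : ℝ} (hz : 0 < z) :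
    HasDerivAt (sinhLaplace g) (-sinhLaplace (fun s => g s * Real.sinh s) z) z := by
  have key := (hasDerivAt_integral_of_dominated_loc_of_deriv_le
    (μ := volume.restrict (Ioi (0:ℝ))) (x₀ := z) (s := Ioi (z / 2))
    (F := fun z s => g s * Real.exp (-z * Real.sinh s))
    (F' := fun z s => -(g s * Real.sinh s * Real.exp (-z * Real.sinh s)))
    (bound := fun s => (1 + Real.sinh s) ^ 1 * Real.exp (-(z / 2) * Real.sinh s))
    (Ioi_mem_nhds (by linarith)) ?_ ?_ ?_ ?_ ?_ ?_).2
  · unfold sinhLaplace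
    rwa [integral_neg] at key
  · exact Eventually.of_forall fun z => Continuous.aestronglyMeasurable (by fun_prop)
  · exact integrableOn_mul_exp_sinh hg 0 (by simpa using hg1) hz
  · exact Continuous.aestronglyMeasurable (by fun_prop)
  · filter_upwards [ae_restrict_mem measurableSet_Ioi] with s hs w hw
    have h0 := Real.sinh_nonneg_iff.2 (le_of_lt hs)
    rw [norm_neg, norm_mul, norm_mul, Real.norm_of_nonneg (Real.exp_pos _).le,
      Real.norm_of_nonneg h0, Real.norm_eq_abs]
    have h1 := hg1 s (le_of_lt hs)
    have hw' : z / 2 ≤ w := le_of_lt hw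
    gcongr
    nlinarith
  · exact integrableOn_one_add_sinh_pow_mul_exp 1 (by linarith)
  · refine Eventually.of_forall fun s w _ => ?_
    have : HasDerivAt (fun w => -w * Real.sinh s) (-1 * Real.sinh s) w :=
      (hasDerivAt_neg w).mul_const _
    refine (this.exp.const_mul (g s)).congr_deriv ?_
    ring

theorem abs_sinhLaplace_le {g : ℝ → ℝ} (hg1 : ∀ s, 0 ≤ s → |g s| ≤ 1) {z : ℝ} (hz : 0 < z) :
    |sinhLaplace g z| ≤ √(Real.pi / 2) * z ^ (-(1:ℝ) / 2) := by
  have hint : IntegrableOn (fun s : ℝ => Real.exp (-(z / 2) * s ^ 2)) (Ioi 0) :=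
    (integrable_exp_neg_mul_sq (by linarith)).integrableOn
  have hle : |sinhLaplace g z| ≤ ∫ s in Ioi (0:ℝ), Real.exp (-(z / 2) * s ^ 2) := by
    rw [← Real.norm_eq_abs]
    refine norm_integral_le_of_norm_le hint ?_
    filter_upwards [ae_restrict_mem measurableSet_Ioi] with s hs
    rw [norm_mul, Real.norm_of_nonneg (Real.exp_pos _).le, Real.norm_eq_abs]
    have h1 := hg1 s (le_of_lt hs)
    have h2 := sq_div_two_le_sinh (le_of_lt hs)
    calc |g s| * Real.exp (-z * Real.sinh s) ≤ 1 * Real.exp (-z * Real.sinh s) := by gcongr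
      _ ≤ Real.exp (-(z / 2) * s ^ 2) := by
        rw [one_mul]; apply Real.exp_le_exp.2; nlinarith
  refine hle.trans (le_of_eq ?_)
  rw [integral_gaussian_Ioi, show -(1:ℝ) / 2 = -(1 / 2) by norm_num, Real.rpow_neg hz.le,
    ← Real.sqrt_eq_rpow, show Real.pi / (z / 2) = (Real.pi / 2) * 4 / z by field_simp; norm_num,
    Real.sqrt_div' _ hz.le, Real.sqrt_mul' _ (by norm_num), show (4:ℝ) = 2 ^ 2 by norm_num,
    Real.sqrt_sq (by norm_num)]
  ring

theorem tendsto_sinh_atTop : Tendsto Real.sinh atTop atTop :=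
  tendsto_atTop_mono' _ ((eventually_ge_atTop 0).mono fun _ h => Real.self_le_sinh_iff.2 h)
    tendsto_id

theorem sinhLaplace_cosh {z : ℝ} (hz : 0 < z) : sinhLaplace Real.cosh z = 1 / z := by
  have hlim : Tendsto (fun s => -(1 / z) * Real.exp (-z * Real.sinh s)) atTop
      (nhds (-(1 / z) * 0)) := by
    refine Tendsto.const_mul _ (Real.tendsto_exp_atBot.comp ?_)
    exact tendsto_sinh_atTop.const_mul_atTop_of_neg (by linarith)
  have := integral_Ioi_of_hasDerivAt_of_tendsto (a := 0)
    (f := fun s => -(1 / z) * Real.exp (-z * Real.sinh s))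
    (f' := fun s => Real.cosh s * Real.exp (-z * Real.sinh s))
    (Continuous.continuousWithinAt (by fun_prop)) (fun s _ => ?_)
    (integrableOn_mul_exp_sinh Real.continuous_cosh 1 (fun s hs => ?_) hz) hlim
  · unfold sinhLaplace
    rw [this]; simp
  · refine ((((Real.hasDerivAt_sinh s).const_mul (-z)).exp).const_mul (-(1 / z))).congr_deriv ?_
    field_simp
  · rw [abs_of_pos (Real.cosh_pos s), pow_one]
    exact cosh_le_one_add_sinh hs

theorem hasDerivAt_sinhLaplace_one {z : ℝ} (hz : 0 < z) :
    HasDerivAt (sinhLaplace fun _ => 1) (sinhLaplace (fun s => Real.exp (-s)) z - 1 / z) z := by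
  convert hasDerivAt_sinhLaplace (g := fun _ => 1) continuous_const (by simp) hz using 1
  rw [← sinhLaplace_cosh hz]
  unfold sinhLaplace
  rw [← integral_sub, ← integral_neg]
  · congr 1 with s
    simp only [← Real.cosh_sub_sinh s]
    ring
  · refine integrableOn_mul_exp_sinh (by fun_prop) 0 (fun s hs => ?_) hz
    rw [abs_of_pos (Real.exp_pos _)]
    simpa using hs
  · refine integrableOn_mul_exp_sinh Real.continuous_cosh 1 (fun s hs => ?_) hz
    rw [abs_of_pos (Real.cosh_pos s), pow_one]
    exact cosh_le_one_add_sinh hs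

theorem sinhLaplace_one_eq_integral_id_mul {z : ℝ} (hz : 0 < z) :
    sinhLaplace (fun _ => 1) z =
      ∫ s in Ioi (0:ℝ), s * (z * Real.cosh s * Real.exp (-z * Real.sinh s)) := by
  have hle {s : ℝ} (hs : 0 ≤ s) : s ≤ 1 + Real.sinh s := by
    linarith [Real.self_le_sinh_iff.2 hs]
  have hint1 : IntegrableOn (fun s => 1 * Real.exp (-z * Real.sinh s)) (Ioi 0) :=
    integrableOn_mul_exp_sinh (g := fun _ => 1) continuous_const 0 (by simp) hz
  have hint2 : IntegrableOn (fun s => s * (z * Real.cosh s * Real.exp (-z * Real.sinh s)))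
      (Ioi 0) := by
    have := (integrableOn_mul_exp_sinh (g := fun s => s * Real.cosh s) (by fun_prop) 2
      (fun s hs => ?_) hz).const_mul z
    · refine IntegrableOn.congr_fun this (fun s _ => ?_) measurableSet_Ioi
      ring
    · rw [abs_of_nonneg (mul_nonneg hs (Real.cosh_pos s).le), pow_two]
      have := cosh_le_one_add_sinh hs
      have := Real.sinh_nonneg_iff.2 hs
      gcongr
      exact hle hs
  have hlim : Tendsto (fun s => s * Real.exp (-z * Real.sinh s)) atTop (nhds 0) := by
    obtain ⟨C, hC⟩ := exists_one_add_sinh_pow_mul_exp_le 1 hz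
    have h0 : Tendsto (fun s => C * Real.exp (-s)) atTop (nhds 0) := by
      simpa using (Real.tendsto_exp_neg_atTop_nhds_zero).const_mul C
    refine squeeze_zero' ?_ ?_ h0
    · filter_upwards [eventually_ge_atTop 0] with s hs
      positivity
    · filter_upwards [eventually_ge_atTop 0] with s hs
      refine le_trans ?_ (hC s hs)
      rw [pow_one]
      gcongr
      exact hle hs
  have := integral_Ioi_of_hasDerivAt_of_tendsto (a := 0)
    (f := fun s => s * Real.exp (-z * Real.sinh s))
    (f' := fun s => 1 * Real.exp (-z * Real.sinh s) -
      s * (z * Real.cosh s * Real.exp (-z * Real.sinh s)))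
    (Continuous.continuousWithinAt (by fun_prop)) (fun s _ => ?_) (hint1.sub hint2) hlim
  · rw [integral_sub hint1 hint2] at this
    unfold sinhLaplace
    simp only [zero_mul, sub_zero] at this
    linarith
  · refine ((hasDerivAt_id s).mul ((Real.hasDerivAt_sinh s).const_mul (-z)).exp).congr_deriv ?_
    simp only [id]
    ring

theorem sinhLaplace_one_eq_integral_arsinh {z : ℝ} (hz : 0 < z) :
    sinhLaplace (fun _ => 1) z = ∫ u in Ioi (0:ℝ), Real.arsinh (u / z) * Real.exp (-u) := by
  have himg : (fun s => z * Real.sinh s) '' Ioi 0 = Ioi 0 := by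
    ext u
    constructor
    · rintro ⟨s, hs, rfl⟩
      exact mul_pos hz (Real.sinh_pos_iff.2 hs)
    · intro hu
      refine ⟨Real.arsinh (u / z), Real.arsinh_pos_iff.2 (div_pos hu hz), ?_⟩
      simp only [Real.sinh_arsinh]
      field_simp
  have hsub := integral_image_eq_integral_abs_deriv_smul (s := Ioi (0:ℝ))
    (f := fun s => z * Real.sinh s) (f' := fun s => z * Real.cosh s) measurableSet_Ioi
    (fun s _ => ((Real.hasDerivAt_sinh s).const_mul z).hasDerivWithinAt)
    (fun s _ t _ h => Real.sinh_injective (mul_left_cancel₀ hz.ne' h))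
    (fun u => Real.arsinh (u / z) * Real.exp (-u))
  rw [himg] at hsub
  rw [sinhLaplace_one_eq_integral_id_mul hz, hsub]
  congr 1 with s
  rw [abs_of_pos (mul_pos hz (Real.cosh_pos s)), mul_div_cancel_left₀ _ hz.ne',
    Real.arsinh_sinh, smul_eq_mul]
  ring_nf

theorem integral_log_mul_exp_neg :
    ∫ u in Ioi (0:ℝ), Real.log u * Real.exp (-u) = -Real.eulerMascheroniConstant := by
  have h1 := Complex.hasDerivAt_GammaIntegral (s := 1) (by simp)
  have h2 : HasDerivAt Complex.GammaIntegral (-(Real.eulerMascheroniConstant : ℂ)) 1 := by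
    refine Complex.hasDerivAt_Gamma_one.congr_of_eventuallyEq ?_
    have : ∀ᶠ s : ℂ in nhds 1, 0 < s.re :=
      Complex.continuous_re.continuousAt.eventually_mem (Ioi_mem_nhds (by simp))
    filter_upwards [this] with s hs
    exact (Complex.Gamma_eq_integral hs).symm
  have h3 := h1.unique h2
  have h4 : ∫ t in Ioi (0:ℝ), (t : ℂ) ^ ((1:ℂ) - 1) * (Real.log t * Real.exp (-t) : ℂ) =
      ((∫ u in Ioi (0:ℝ), Real.log u * Real.exp (-u) : ℝ) : ℂ) := by
    rw [← integral_complex_ofReal]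
    congr 1 with t
    simp
  rw [h4] at h3
  exact_mod_cast h3

theorem abs_arsinh_sub_log_two_mul_le {x : ℝ} (hx : 0 < x) :
    |Real.arsinh x - Real.log (2 * x)| ≤ 2 * x ^ (-(1:ℝ) / 2) := by
  have hsqrt1 : x ≤ √(1 + x ^ 2) := Real.le_sqrt_of_sq_le (by linarith)
  have hsqrt2 : √(1 + x ^ 2) ≤ 1 + x := Real.sqrt_le_iff.2 ⟨by linarith, by nlinarith⟩
  have hy : x ^ (-(1:ℝ) / 2) = (√x)⁻¹ := by
    rw [show -(1:ℝ) / 2 = -(1 / 2) by norm_num, Real.rpow_neg hx.le, ← Real.sqrt_eq_rpow]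
  have hy0 : 0 < (√x)⁻¹ := by positivity
  have hyx : (√x)⁻¹ ^ 2 * x = 1 := by
    rw [inv_pow, Real.sq_sqrt hx.le, inv_mul_cancel₀ hx.ne']
  rw [hy, Real.arsinh, ← Real.log_div (by positivity) (by positivity), abs_of_nonneg]
  · calc Real.log ((x + √(1 + x ^ 2)) / (2 * x)) ≤ Real.log ((1 + (√x)⁻¹) ^ 2) := by
          apply Real.log_le_log (by positivity)
          rw [div_le_iff₀ (by positivity)]
          nlinarith [mul_pos hy0 hx]
      _ = 2 * Real.log (1 + (√x)⁻¹) := by rw [Real.log_pow]; norm_num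
      _ ≤ 2 * (√x)⁻¹ := by
          gcongr
          have := Real.log_le_sub_one_of_pos (x := 1 + (√x)⁻¹) (by positivity)
          linarith
  · apply Real.log_nonneg
    rw [le_div_iff₀ (by positivity)]
    linarith

theorem abs_sinhLaplace_one_add_log_le {z : ℝ} (hz : 0 < z) :
    |sinhLaplace (fun _ => 1) z + Real.log (z / 2) + Real.eulerMascheroniConstant| ≤
      2 * √Real.pi * z ^ ((1:ℝ) / 2) := by
  have hexp : IntegrableOn (fun u : ℝ => Real.exp (-u)) (Ioi 0) := by
    simpa using exp_neg_integrableOn_Ioi 0 one_pos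
  have hgam : IntegrableOn (fun u : ℝ => Real.exp (-u) * u ^ ((1:ℝ) / 2 - 1)) (Ioi 0) :=
    Real.GammaIntegral_convergent (by norm_num)
  have hars : IntegrableOn (fun u : ℝ => Real.arsinh (u / z) * Real.exp (-u)) (Ioi 0) := by
    have h2 := (Real.GammaIntegral_convergent (s := 2) (by norm_num)).const_mul z⁻¹
    have hcont := Real.continuous_arsinh.comp (continuous_id.div_const z)
    refine Integrable.mono' h2 (hcont.mul (by fun_prop)).aestronglyMeasurable ?_
    filter_upwards [ae_restrict_mem measurableSet_Ioi] with u hu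
    have hu0 : 0 < u / z := div_pos hu hz
    have h0 : 0 ≤ Real.arsinh (u / z) := Real.arsinh_nonneg_iff.2 hu0.le
    have h1 : Real.arsinh (u / z) ≤ u / z := by
      simpa using Real.self_le_sinh_iff.2 h0
    rw [Real.norm_of_nonneg (by positivity), show (2:ℝ) - 1 = 1 by norm_num, Real.rpow_one]
    calc Real.arsinh (u / z) * Real.exp (-u) ≤ u / z * Real.exp (-u) := by gcongr
      _ = _ := by ring
  have hbd : ∀ u ∈ Ioi (0:ℝ),
      ‖(Real.arsinh (u / z) + Real.log (z / 2) - Real.log u) * Real.exp (-u)‖ ≤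
        2 * z ^ ((1:ℝ) / 2) * (Real.exp (-u) * u ^ ((1:ℝ) / 2 - 1)) := by
    intro u hu
    have hu0 : 0 < u := hu
    have h := abs_arsinh_sub_log_two_mul_le (div_pos hu0 hz)
    have hlog : Real.arsinh (u / z) + Real.log (z / 2) - Real.log u =
        Real.arsinh (u / z) - Real.log (2 * (u / z)) := by
      rw [Real.log_mul (by norm_num) (by positivity), Real.log_div hz.ne' (by norm_num),
        Real.log_div hu0.ne' hz.ne']
      ring
    rw [norm_mul, Real.norm_of_nonneg (Real.exp_pos _).le, hlog, Real.norm_eq_abs]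
    calc _ ≤ 2 * (u / z) ^ (-(1:ℝ) / 2) * Real.exp (-u) := by gcongr
      _ = _ := by
        have hz2 : z ^ ((1:ℝ) / 2) = (z ^ (-(1:ℝ) / 2))⁻¹ := by
          rw [← Real.rpow_neg hz.le]; norm_num
        rw [Real.div_rpow hu0.le hz.le, show (1:ℝ) / 2 - 1 = -(1:ℝ) / 2 by norm_num, hz2]
        ring
  have hdiff : IntegrableOn
      (fun u : ℝ => (Real.arsinh (u / z) + Real.log (z / 2) - Real.log u) * Real.exp (-u))
      (Ioi 0) := by
    refine Integrable.mono' (hgam.const_mul (2 * z ^ ((1:ℝ) / 2))) ?_ ?_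
    · have := Real.continuous_arsinh.measurable
      exact Measurable.aestronglyMeasurable (by fun_prop)
    · filter_upwards [ae_restrict_mem measurableSet_Ioi] with u hu using hbd u hu
  have hlog : IntegrableOn (fun u : ℝ => Real.log u * Real.exp (-u)) (Ioi 0) := by
    refine ((hars.add (hexp.const_mul (Real.log (z / 2)))).sub hdiff).congr_fun
      (fun u _ => ?_) measurableSet_Ioi
    simp only [Pi.add_apply, Pi.sub_apply]
    ring
  have heq : sinhLaplace (fun _ => 1) z + Real.log (z / 2) + Real.eulerMascheroniConstant =
      ∫ u in Ioi (0:ℝ), (Real.arsinh (u / z) + Real.log (z / 2) - Real.log u) *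
        Real.exp (-u) := by
    have hsplit : (fun u : ℝ => (Real.arsinh (u / z) + Real.log (z / 2) - Real.log u) *
        Real.exp (-u)) = fun u => (Real.arsinh (u / z) * Real.exp (-u) +
          Real.log (z / 2) * Real.exp (-u)) - Real.log u * Real.exp (-u) := by
      ext u; ring
    have hsum : IntegrableOn (fun u => Real.arsinh (u / z) * Real.exp (-u) +
        Real.log (z / 2) * Real.exp (-u)) (Ioi 0) := hars.add (hexp.const_mul _)
    rw [hsplit, integral_sub hsum hlog,
      integral_add hars (hexp.const_mul _), integral_const_mul, integral_exp_neg_Ioi_zero,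
      integral_log_mul_exp_neg, sinhLaplace_one_eq_integral_arsinh hz]
    ring
  rw [heq, ← Real.norm_eq_abs]
  refine (norm_integral_le_of_norm_le (hgam.const_mul (2 * z ^ ((1:ℝ) / 2))) ?_).trans
    (le_of_eq ?_)
  · filter_upwards [ae_restrict_mem measurableSet_Ioi] with u hu using hbd u hu
  · rw [integral_const_mul, ← Real.Gamma_eq_integral (by norm_num), Real.Gamma_one_half_eq]
    ring

/-- The oscillatory integral `∫₀^{π/2} cosⁿθ exp(i w cos θ) dθ`. -/
def cosOsc (n : ℕ) (w : ℝ) : ℂ :=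
  ∫ θ in (0:ℝ)..(Real.pi / 2),
    ((Real.cos θ : ℝ) : ℂ) ^ n * Complex.exp (Complex.I * ((w * Real.cos θ : ℝ) : ℂ))

theorem norm_exp_I_mul_real (a : ℝ) : ‖Complex.exp (Complex.I * (a : ℂ))‖ = 1 := by
  rw [mul_comm, Complex.norm_exp_ofReal_mul_I]

theorem norm_cos_pow_mul_exp_le (n : ℕ) (w θ : ℝ) :
    ‖((Real.cos θ : ℝ) : ℂ) ^ n * Complex.exp (Complex.I * ((w * Real.cos θ : ℝ) : ℂ))‖ ≤ 1 := by
  rw [norm_mul, norm_exp_I_mul_real, mul_one, norm_pow, Complex.norm_real, Real.norm_eq_abs]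
  exact pow_le_one₀ (abs_nonneg _) (Real.abs_cos_le_one θ)

theorem continuous_cos_pow_mul_exp (n : ℕ) (w : ℝ) : Continuous fun θ : ℝ =>
    ((Real.cos θ : ℝ) : ℂ) ^ n * Complex.exp (Complex.I * ((w * Real.cos θ : ℝ) : ℂ)) := by
  fun_prop

theorem hasDerivAt_cosOsc (n : ℕ) (w : ℝ) :
    HasDerivAt (cosOsc n) (Complex.I * cosOsc (n + 1) w) w := by
  have key := (intervalIntegral.hasDerivAt_integral_of_dominated_loc_of_deriv_le
    (μ := volume) (x₀ := w) (s := univ) (a := 0) (b := Real.pi / 2)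
    (F := fun (w : ℝ) (θ : ℝ) => ((Real.cos θ : ℝ) : ℂ) ^ n *
      Complex.exp (Complex.I * ((w * Real.cos θ : ℝ) : ℂ)))
    (F' := fun (w : ℝ) (θ : ℝ) => Complex.I * (((Real.cos θ : ℝ) : ℂ) ^ (n + 1) *
      Complex.exp (Complex.I * ((w * Real.cos θ : ℝ) : ℂ))))
    (bound := fun _ => 1) univ_mem ?_ ?_ ?_ ?_ ?_ ?_).2
  · rwa [intervalIntegral.integral_const_mul] at key
  · exact Eventually.of_forall fun w => (continuous_cos_pow_mul_exp n w).aestronglyMeasurable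
  · exact (continuous_cos_pow_mul_exp n w).intervalIntegrable _ _
  · exact ((continuous_cos_pow_mul_exp (n + 1) w).const_smul Complex.I).aestronglyMeasurable
  · refine Eventually.of_forall fun θ _ w _ => ?_
    rw [norm_mul, Complex.norm_I, one_mul]
    exact norm_cos_pow_mul_exp_le _ _ _
  · exact intervalIntegrable_const
  · refine Eventually.of_forall fun θ _ w _ => ?_
    have h1 : HasDerivAt (fun w : ℝ => w * Real.cos θ) (Real.cos θ) w := hasDerivAt_mul_const _
    refine (((h1.ofReal_comp.const_mul Complex.I).cexp).const_mul _).congr_deriv ?_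
    ring

theorem norm_integral_cos_pow_mul_exp_le (n : ℕ) {w δ : ℝ} (hδ : 0 < δ) (hδ' : δ ≤ Real.pi / 2) :
    |w| * ‖∫ θ in δ..(Real.pi / 2), ((Real.cos θ : ℝ) : ℂ) ^ (n + 1) *
      Complex.exp (Complex.I * ((w * Real.cos θ : ℝ) : ℂ))‖ ≤ (n + 3) / Real.sin δ := by
  set e : ℝ → ℂ := fun θ => Complex.exp (Complex.I * ((w * Real.cos θ : ℝ) : ℂ))
  have hec : Continuous e := by fun_prop
  have hsin : ∀ θ ∈ Icc δ (Real.pi / 2), 0 < Real.sin θ := fun θ hθ =>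
    Real.sin_pos_of_pos_of_lt_pi (hδ.trans_le hθ.1) (by linarith [hθ.2, Real.pi_pos])
  have hsinδ := hsin δ ⟨le_rfl, hδ'⟩
  have hu : uIcc δ (Real.pi / 2) = Icc δ (Real.pi / 2) := uIcc_of_le hδ'
  let h : ℝ → ℝ := fun θ =>
    (n + 1) * Real.cos θ ^ n + Real.cos θ ^ (n + 2) / Real.sin θ ^ 2
  have hsqc : ContinuousOn (fun θ => 1 / Real.sin θ ^ 2) (Icc δ (Real.pi / 2)) :=
    continuousOn_const.div (by fun_prop) fun θ hθ => (pow_pos (hsin θ hθ) 2).ne'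
  have hhc : ContinuousOn h (Icc δ (Real.pi / 2)) :=
    ContinuousOn.add (by fun_prop)
      (ContinuousOn.div (by fun_prop) (by fun_prop) fun θ hθ => (pow_pos (hsin θ hθ) 2).ne')
  have hint1 : IntervalIntegrable (fun θ => (h θ : ℂ) * e θ) volume δ (Real.pi / 2) := by
    apply ContinuousOn.intervalIntegrable
    rw [hu]
    exact (Complex.continuous_ofReal.comp_continuousOn hhc).mul hec.continuousOn
  have hint2 : IntervalIntegrable
      (fun θ => Complex.I * w * (((Real.cos θ : ℝ) : ℂ) ^ (n + 1) * e θ))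
      volume δ (Real.pi / 2) :=
    (continuous_const.mul (continuous_cos_pow_mul_exp (n + 1) w)).intervalIntegrable _ _
  have hint3 : IntervalIntegrable (fun θ => 1 / Real.sin θ ^ 2) volume δ (Real.pi / 2) := by
    apply ContinuousOn.intervalIntegrable
    rwa [hu]
  have hderiv : ∀ θ ∈ uIcc δ (Real.pi / 2), HasDerivAt
      (fun θ : ℝ => ((Real.cos θ ^ (n + 1) / Real.sin θ : ℝ) : ℂ) * e θ)
      (-((h θ : ℂ) * e θ) - Complex.I * w * (((Real.cos θ : ℝ) : ℂ) ^ (n + 1) * e θ)) θ := by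
    intro θ hθ
    rw [hu] at hθ
    have hs := (hsin θ hθ).ne'
    have h1 : HasDerivAt (fun θ => Real.cos θ ^ (n + 1) / Real.sin θ) (-h θ) θ := by
      refine (((Real.hasDerivAt_cos θ).pow (n + 1)).div (Real.hasDerivAt_sin θ) hs).congr_deriv ?_
      simp only [h, Nat.add_sub_cancel, Pi.pow_apply]
      field_simp
      push_cast
      ring
    have h2 : HasDerivAt e (e θ * (Complex.I * ((w * -Real.sin θ : ℝ) : ℂ))) θ :=
      (((Real.hasDerivAt_cos θ).const_mul w).ofReal_comp.const_mul Complex.I).cexp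
    refine (h1.ofReal_comp.mul h2).congr_deriv ?_
    have hs' : (Real.sin θ : ℂ) ≠ 0 := by exact_mod_cast hs
    push_cast
    push_cast at hs'
    field_simp
    ring
  have hint1n : IntervalIntegrable (fun θ => -((h θ : ℂ) * e θ)) volume δ (Real.pi / 2) :=
    hint1.neg
  have hftc := intervalIntegral.integral_eq_sub_of_hasDerivAt hderiv (hint1n.sub hint2)
  rw [intervalIntegral.integral_sub hint1n hint2, intervalIntegral.integral_neg,
    intervalIntegral.integral_const_mul] at hftc
  have hcot : ∫ θ in δ..(Real.pi / 2), 1 / Real.sin θ ^ 2 = Real.cos δ / Real.sin δ := by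
    rw [intervalIntegral.integral_eq_sub_of_hasDerivAt
      (f := fun θ => -(Real.cos θ / Real.sin θ)) (fun θ hθ => ?_) hint3]
    · simp
    · rw [hu] at hθ
      have hs := (hsin θ hθ).ne'
      refine (((Real.hasDerivAt_cos θ).div (Real.hasDerivAt_sin θ) hs).neg).congr_deriv ?_
      field_simp
      linarith [Real.sin_sq_add_cos_sq θ]
  have hR : ‖∫ θ in δ..(Real.pi / 2), (h θ : ℂ) * e θ‖ ≤ (n + 2) / Real.sin δ := by
    refine (intervalIntegral.norm_integral_le_of_norm_le hδ'
      (g := fun θ => (n + 2) * (1 / Real.sin θ ^ 2))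
      (Eventually.of_forall fun θ hθ => ?_) (hint3.const_mul _)).trans ?_
    · have hs := hsin θ ⟨hθ.1.le, hθ.2⟩
      have hc0 : 0 ≤ Real.cos θ :=
        Real.cos_nonneg_of_mem_Icc ⟨by linarith [hθ.1, Real.pi_pos], hθ.2⟩
      have hp (k : ℕ) : Real.cos θ ^ k ≤ 1 := pow_le_one₀ hc0 (Real.cos_le_one θ)
      have hsq : 1 ≤ 1 / Real.sin θ ^ 2 := by
        rw [le_div_iff₀ (by positivity), one_mul]
        exact pow_le_one₀ hs.le (Real.sin_le_one θ)
      rw [norm_mul, norm_exp_I_mul_real, mul_one, Complex.norm_real,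
        Real.norm_of_nonneg (by positivity)]
      calc h θ ≤ (n + 1) * 1 + 1 / Real.sin θ ^ 2 := by
            simp only [h]
            gcongr
            · exact hp n
            · exact hp (n + 2)
        _ ≤ (n + 1) * (1 / Real.sin θ ^ 2) + 1 / Real.sin θ ^ 2 := by gcongr
        _ = _ := by ring
    · rw [intervalIntegral.integral_const_mul, hcot, mul_div_assoc']
      gcongr
      exact mul_le_of_le_one_right (by positivity) (Real.cos_le_one δ)
  have hΦ : ‖((Real.cos δ ^ (n + 1) / Real.sin δ : ℝ) : ℂ) * e δ‖ ≤ 1 / Real.sin δ := by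
    rw [norm_mul, norm_exp_I_mul_real, mul_one, Complex.norm_real, norm_div, norm_pow,
      Real.norm_of_nonneg hsinδ.le, Real.norm_eq_abs]
    gcongr
    exact pow_le_one₀ (abs_nonneg _) (Real.abs_cos_le_one δ)
  have heq : Complex.I * w * (∫ θ in δ..(Real.pi / 2), ((Real.cos θ : ℝ) : ℂ) ^ (n + 1) * e θ) =
      ((Real.cos δ ^ (n + 1) / Real.sin δ : ℝ) : ℂ) * e δ -
        ∫ θ in δ..(Real.pi / 2), (h θ : ℂ) * e θ := by
    have h0 : ((Real.cos (Real.pi / 2) ^ (n + 1) / Real.sin (Real.pi / 2) : ℝ) : ℂ) = 0 := by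
      simp
    simp only [h0, zero_mul, zero_sub] at hftc
    linear_combination -hftc
  have hnorm := congrArg norm heq
  rw [norm_mul, norm_mul, Complex.norm_I, one_mul, Complex.norm_real, Real.norm_eq_abs] at hnorm
  rw [hnorm]
  refine (norm_sub_le _ _).trans ((add_le_add hΦ hR).trans (le_of_eq ?_))
  ring

theorem norm_cosOsc_succ_le (n : ℕ) {w : ℝ} (hw : w ≠ 0) :
    ‖cosOsc (n + 1) w‖ ≤ (2 * n + 7) * |w| ^ (-(1:ℝ) / 2) := by
  have hw0 : 0 < |w| := abs_pos.2 hw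
  have hpi := Real.pi_le_four
  have hpi3 := Real.pi_gt_three
  set δ : ℝ := |w| ^ (-(1:ℝ) / 2) with hδdef
  have hδ : 0 < δ := Real.rpow_pos_of_pos hw0 _
  have hδw : δ ^ 2 * |w| = 1 := by
    rw [hδdef, ← Real.rpow_natCast, ← Real.rpow_mul hw0.le, ← Real.rpow_add_one hw0.ne']
    norm_num
  have hconst (a b : ℝ) := intervalIntegral.norm_integral_le_of_norm_le_const
    (a := a) (b := b) (C := 1) (fun θ _ => norm_cos_pow_mul_exp_le (n + 1) w θ)
  rcases le_or_gt δ 1 with h1 | h1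
  · have hδ' : δ ≤ Real.pi / 2 := by linarith
    have hint (a b : ℝ) := (continuous_cos_pow_mul_exp (n + 1) w).intervalIntegrable
      (μ := volume) a b
    have hA := hconst 0 δ
    have hB := norm_integral_cos_pow_mul_exp_le n (w := w) hδ hδ'
    have hs := Real.mul_le_sin hδ.le hδ'
    have hsin : δ / 2 ≤ Real.sin δ := by
      refine le_trans ?_ hs
      rw [div_mul_eq_mul_div, div_le_div_iff₀ (by norm_num) Real.pi_pos]
      nlinarith
    have hB' : |w| * ‖∫ θ in δ..(Real.pi / 2), ((Real.cos θ : ℝ) : ℂ) ^ (n + 1) *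
        Complex.exp (Complex.I * ((w * Real.cos θ : ℝ) : ℂ))‖ ≤ |w| * ((2 * n + 6) * δ) := by
      refine hB.trans ?_
      calc ((n : ℝ) + 3) / Real.sin δ ≤ (n + 3) / (δ / 2) := by gcongr
        _ = |w| * ((2 * n + 6) * δ) := by
          rw [div_eq_iff (by positivity)]
          linear_combination -((n : ℝ) + 3) * hδw
    have hB'' := le_of_mul_le_mul_left hB' hw0
    rw [sub_zero, abs_of_pos hδ, one_mul] at hA
    rw [cosOsc, ← intervalIntegral.integral_add_adjacent_intervals (hint 0 δ) (hint δ _)]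
    refine (norm_add_le _ _).trans ((add_le_add hA hB'').trans (le_of_eq ?_))
    ring
  · have := hconst 0 (Real.pi / 2)
    rw [sub_zero, abs_of_pos (by positivity), one_mul] at this
    refine this.trans ?_
    have : (0:ℝ) ≤ n * δ := by positivity
    nlinarith

theorem norm_cosOsc_zero_sub_le (w : ℝ) :
    ‖cosOsc 0 w - (Real.pi / 2 : ℝ)‖ ≤ 4 * |w| ^ ((1:ℝ) / 2) := by
  have hint := (continuous_cos_pow_mul_exp 0 w).intervalIntegrable (μ := volume) 0 (Real.pi / 2)
  have hpi := Real.pi_le_four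
  have heq : cosOsc 0 w - (Real.pi / 2 : ℝ) = ∫ θ in (0:ℝ)..(Real.pi / 2),
      (((Real.cos θ : ℝ) : ℂ) ^ 0 * Complex.exp (Complex.I * ((w * Real.cos θ : ℝ) : ℂ)) - 1) := by
    rw [intervalIntegral.integral_sub hint intervalIntegrable_const, cosOsc]
    simp
  have hbd : ∀ θ ∈ uIoc 0 (Real.pi / 2), ‖((Real.cos θ : ℝ) : ℂ) ^ 0 *
      Complex.exp (Complex.I * ((w * Real.cos θ : ℝ) : ℂ)) - 1‖ ≤ 2 * |w| ^ ((1:ℝ) / 2) := by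
    intro θ _
    rw [pow_zero, one_mul, ← Real.sqrt_eq_rpow]
    have h1 : ‖Complex.exp (Complex.I * ((w * Real.cos θ : ℝ) : ℂ)) - 1‖ ≤ |w| := by
      refine Real.norm_exp_I_mul_ofReal_sub_one_le.trans ?_
      rw [norm_mul, Real.norm_eq_abs, Real.norm_eq_abs]
      exact mul_le_of_le_one_right (abs_nonneg _) (Real.abs_cos_le_one θ)
    have h2 : ‖Complex.exp (Complex.I * ((w * Real.cos θ : ℝ) : ℂ)) - 1‖ ≤ 2 := by
      refine (norm_sub_le _ _).trans ?_
      rw [norm_exp_I_mul_real, norm_one]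
      norm_num
    have h3 := Real.sq_sqrt (abs_nonneg w)
    have h4 := Real.sqrt_nonneg |w|
    rcases le_or_gt (√|w|) 1 with h | h <;> nlinarith
  rw [heq]
  refine (intervalIntegral.norm_integral_le_of_norm_le_const hbd).trans ?_
  rw [sub_zero, abs_of_pos Real.pi_div_two_pos]
  have : 0 ≤ |w| ^ ((1:ℝ) / 2) := by positivity
  nlinarith

theorem cosOsc_zero_eq (w : ℝ) : cosOsc 0 w =
    ((∫ θ in (0:ℝ)..(Real.pi / 2), Real.cos (w * Real.cos θ) : ℝ) : ℂ) +
      ((∫ θ in (0:ℝ)..(Real.pi / 2), Real.sin (w * Real.cos θ) : ℝ) : ℂ) * Complex.I := by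
  have h1 : IntervalIntegrable (fun θ => ((Real.cos (w * Real.cos θ) : ℝ) : ℂ)) volume 0
      (Real.pi / 2) := Continuous.intervalIntegrable (by fun_prop) _ _
  have h2 : IntervalIntegrable (fun θ => ((Real.sin (w * Real.cos θ) : ℝ) : ℂ) * Complex.I)
      volume 0 (Real.pi / 2) := Continuous.intervalIntegrable (by fun_prop) _ _
  rw [← intervalIntegral.integral_ofReal, ← intervalIntegral.integral_ofReal,
    ← intervalIntegral.integral_mul_const, ← intervalIntegral.integral_add h1 h2, cosOsc]
  congr 1 with θ
  rw [pow_zero, one_mul, mul_comm, Complex.exp_mul_I, Complex.ofReal_cos, Complex.ofReal_sin]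

theorem J0_eq (z : ℝ) :
    J0 z = (2 / Real.pi) * ∫ θ in (0:ℝ)..(Real.pi / 2), Real.cos (z * Real.cos θ) := by
  have hint (a b : ℝ) : IntervalIntegrable (fun θ => Real.cos (z * Real.sin θ)) volume a b :=
    Continuous.intervalIntegrable (by fun_prop) _ _
  have h1 := intervalIntegral.integral_comp_sub_left (a := 0) (b := Real.pi / 2)
    (fun θ => Real.cos (z * Real.sin θ)) (Real.pi / 2)
  have h2 := intervalIntegral.integral_comp_add_right (a := 0) (b := Real.pi / 2)
    (fun θ => Real.cos (z * Real.sin θ)) (Real.pi / 2)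
  simp only [Real.sin_pi_div_two_sub, Real.sin_add_pi_div_two, sub_self, sub_zero, zero_add,
    add_halves] at h1 h2
  rw [J0, ← intervalIntegral.integral_add_adjacent_intervals (hint 0 (Real.pi / 2))
    (hint (Real.pi / 2) Real.pi), ← h1, ← h2]
  ring

theorem integral_exp_mul_cosh_eq (z T : ℝ) :
    ∫ t in (0:ℝ)..T, Complex.exp (Complex.I * ((z * Real.cosh t : ℝ) : ℂ)) =
      ((∫ t in (0:ℝ)..T, Real.exp (-z * Real.sinh t) : ℝ) : ℂ) -
        Complex.I * (∫ y in (0:ℝ)..(Real.pi / 2),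
          Complex.exp (Complex.I * (z * Complex.cosh (T + y * Complex.I)))) +
        Complex.I * cosOsc 0 z := by
  have hrect := Complex.integral_boundary_rect_eq_zero_of_differentiableOn
    (fun t => Complex.exp (Complex.I * (z * Complex.cosh t))) 0
    ⟨T, Real.pi / 2⟩ (Differentiable.differentiableOn (by fun_prop))
  have htop : ∀ x : ℝ, Complex.exp (Complex.I *
      (z * Complex.cosh (x + (Real.pi / 2 : ℝ) * Complex.I))) =
        ((Real.exp (-z * Real.sinh x) : ℝ) : ℂ) := by
    intro x
    rw [Complex.cosh_add, Complex.cosh_mul_I, Complex.sinh_mul_I, ← Complex.ofReal_cos,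
      ← Complex.ofReal_sin, Real.cos_pi_div_two, Real.sin_pi_div_two]
    push_cast
    congr 1
    linear_combination (z * Complex.sinh x) * Complex.I_sq
  have hleft : ∀ y : ℝ, Complex.exp (Complex.I * (z * Complex.cosh (y * Complex.I))) =
      ((Real.cos y : ℝ) : ℂ) ^ 0 * Complex.exp (Complex.I * ((z * Real.cos y : ℝ) : ℂ)) := by
    intro y
    rw [Complex.cosh_mul_I]
    push_cast
    ring
  simp only [Complex.zero_re, Complex.zero_im, Complex.ofReal_zero, zero_mul, add_zero, zero_add,
    htop, hleft, smul_eq_mul] at hrect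
  rw [intervalIntegral.integral_ofReal] at hrect
  have hbot : ∫ t in (0:ℝ)..T, Complex.exp (Complex.I * ((z * Real.cosh t : ℝ) : ℂ)) =
      ∫ t in (0:ℝ)..T, Complex.exp (Complex.I * (z * Complex.cosh t)) := by
    congr 1 with t
    push_cast
    rfl
  rw [hbot, cosOsc]
  linear_combination hrect

theorem tendsto_integral_exp_mul_cosh_vertical {z : ℝ} (hz : 0 < z) :
    Tendsto (fun T : ℝ => ∫ y in (0:ℝ)..(Real.pi / 2),
      Complex.exp (Complex.I * (z * Complex.cosh (T + y * Complex.I)))) atTop (nhds 0) := by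
  have hnorm : ∀ T y : ℝ, ‖Complex.exp (Complex.I * (z * Complex.cosh (T + y * Complex.I)))‖ =
      Real.exp (-z * Real.sin y * Real.sinh T) := by
    intro T y
    rw [Complex.norm_exp, Complex.cosh_add, Complex.cosh_mul_I, Complex.sinh_mul_I,
      ← Complex.ofReal_cos, ← Complex.ofReal_sin, ← Complex.ofReal_cosh, ← Complex.ofReal_sinh]
    congr 1
    simp only [Complex.mul_re, Complex.mul_im, Complex.add_re, Complex.add_im, Complex.I_re,
      Complex.I_im, Complex.ofReal_re, Complex.ofReal_im]
    ring
  have hsin : ∀ y ∈ uIoc 0 (Real.pi / 2), 0 < Real.sin y := by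
    intro y hy
    rw [uIoc_of_le Real.pi_div_two_pos.le] at hy
    exact Real.sin_pos_of_pos_of_lt_pi hy.1 (by linarith [hy.2, Real.pi_pos])
  have := intervalIntegral.tendsto_integral_filter_of_dominated_convergence
    (μ := volume) (a := 0) (b := Real.pi / 2) (l := atTop) (f := fun _ => (0:ℂ))
    (F := fun (T y : ℝ) => Complex.exp (Complex.I * (z * Complex.cosh (T + y * Complex.I))))
    (fun _ => 1) ?_ ?_ intervalIntegrable_const ?_
  · simpa using this
  · exact Eventually.of_forall fun T => Continuous.aestronglyMeasurable (by fun_prop)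
  · filter_upwards [eventually_ge_atTop 0] with T hT
    refine Eventually.of_forall fun y hy => ?_
    rw [hnorm, Real.exp_le_one_iff, neg_mul, neg_mul, neg_nonpos]
    have := hsin y hy
    have := Real.sinh_nonneg_iff.2 hT
    positivity
  · refine Eventually.of_forall fun y hy => ?_
    rw [tendsto_zero_iff_norm_tendsto_zero]
    simp only [hnorm]
    refine Real.tendsto_exp_atBot.comp (tendsto_sinh_atTop.const_mul_atTop_of_neg ?_)
    have := mul_pos hz (hsin y hy)
    linarith

theorem Y0_eq {z : ℝ} (hz : 0 < z) :
    Y0 z = (2 / Real.pi) * ((∫ θ in (0:ℝ)..(Real.pi / 2), Real.sin (z * Real.cos θ)) -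
      sinhLaplace (fun _ => 1) z) := by
  have hint : IntegrableOn (fun s => 1 * Real.exp (-z * Real.sinh s)) (Ioi 0) :=
    integrableOn_mul_exp_sinh (g := fun _ => 1) continuous_const 0 (by simp) hz
  have h1 : Tendsto (fun T : ℝ => ∫ t in (0:ℝ)..T, Real.exp (-z * Real.sinh t)) atTop
      (nhds (sinhLaplace (fun _ => 1) z)) := by
    have := intervalIntegral_tendsto_integral_Ioi 0 hint tendsto_id
    simpa [sinhLaplace] using this
  have h2 := (((Complex.continuous_ofReal.tendsto _).comp h1).sub
    ((tendsto_integral_exp_mul_cosh_vertical hz).const_mul Complex.I)).add_const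
      (Complex.I * cosOsc 0 z)
  have h3 := (Complex.continuous_re.tendsto _).comp h2
  have hre : ∀ T : ℝ, (∫ t in (0:ℝ)..T,
      Complex.exp (Complex.I * ((z * Real.cosh t : ℝ) : ℂ))).re =
        ∫ t in (0:ℝ)..T, Real.cos (z * Real.cosh t) := by
    intro T
    have hi : IntervalIntegrable
        (fun t : ℝ => Complex.exp (Complex.I * ((z * Real.cosh t : ℝ) : ℂ))) volume 0 T :=
      Continuous.intervalIntegrable (by fun_prop) _ _
    rw [← Complex.reCLM_apply, ← ContinuousLinearMap.intervalIntegral_comp_comm _ hi]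
    congr 1 with t
    rw [Complex.reCLM_apply, mul_comm, Complex.exp_ofReal_mul_I_re]
  have h4 : Tendsto (fun T : ℝ => ∫ t in (0:ℝ)..T, Real.cos (z * Real.cosh t)) atTop
      (nhds (sinhLaplace (fun _ => 1) z -
        ∫ θ in (0:ℝ)..(Real.pi / 2), Real.sin (z * Real.cos θ))) := by
    convert h3 using 1
    · ext T
      rw [← hre, integral_exp_mul_cosh_eq]
      rfl
    · rw [cosOsc_zero_eq]
      simp
      ring
  rw [Y0, h4.limUnder_eq]
  ring

/-- The error term as a function of `z = λ|x - y|`. -/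
def radialError (ε z : ℝ) : ℂ :=
  (1 / (2 * Real.pi) : ℝ) * (ε * Complex.I * (cosOsc 0 (ε * z) - (Real.pi / 2 : ℝ)) +
    ((sinhLaplace (fun _ => 1) z + Real.log (z / 2) + Real.eulerMascheroniConstant : ℝ) : ℂ))

/-- The first derivative of `radialError`. -/
def radialError' (ε z : ℝ) : ℂ :=
  (1 / (2 * Real.pi) : ℝ) * (-cosOsc 1 (ε * z) + (sinhLaplace (fun s => Real.exp (-s)) z : ℂ))

/-- The second derivative of `radialError`. -/
def radialError'' (ε z : ℝ) : ℂ :=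
  (1 / (2 * Real.pi) : ℝ) * (-(ε * Complex.I * cosOsc 2 (ε * z)) -
    (sinhLaplace (fun s => Real.exp (-s) * Real.sinh s) z : ℂ))

theorem cosOsc_zero_neg (w : ℝ) : cosOsc 0 (-w) =
    ((∫ θ in (0:ℝ)..(Real.pi / 2), Real.cos (w * Real.cos θ) : ℝ) : ℂ) -
      ((∫ θ in (0:ℝ)..(Real.pi / 2), Real.sin (w * Real.cos θ) : ℝ) : ℂ) * Complex.I := by
  rw [cosOsc_zero_eq]
  simp only [neg_mul, Real.cos_neg, Real.sin_neg, intervalIntegral.integral_neg]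
  push_cast
  ring

theorem E0_eq_radialError {ε : ℝ} (hε : ε = 1 ∨ ε = -1) {l : ℝ} (hl : 0 < l) {x y : Plane}
    (hxy : x ≠ y) : E0 ε l x y = radialError ε (l * ‖x - y‖) := by
  have hr : 0 < ‖x - y‖ := norm_pos_iff.2 (sub_ne_zero.2 hxy)
  have hlog : Real.log (l * ‖x - y‖ / 2) = Real.log (l / 2) + Real.log ‖x - y‖ := by
    rw [← Real.log_mul (by positivity) hr.ne']
    ring_nf
  have hpi : (Real.pi : ℂ) ≠ 0 := by exact_mod_cast Real.pi_ne_zero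
  rw [E0, H0, J0_eq, Y0_eq (mul_pos hl hr), radialError, hlog]
  rcases hε with rfl | rfl
  · rw [one_mul, cosOsc_zero_eq]
    push_cast
    field_simp
    ring_nf
    simp only [Complex.I_sq]
    ring
  · rw [neg_one_mul, cosOsc_zero_neg]
    push_cast
    field_simp
    ring_nf
    simp only [Complex.I_sq]
    ring

theorem hasDerivAt_cosOsc_const_mul (n : ℕ) (ε z : ℝ) :
    HasDerivAt (fun z => cosOsc n (ε * z)) (ε * (Complex.I * cosOsc (n + 1) (ε * z))) z := by
  have h : HasDerivAt (fun z => ε * z) ε z := hasDerivAt_const_mul ε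
  exact (hasDerivAt_cosOsc n (ε * z)).scomp z h

theorem hasDerivAt_radialError {ε : ℝ} (hε : ε = 1 ∨ ε = -1) {z : ℝ} (hz : 0 < z) :
    HasDerivAt (radialError ε) (radialError' ε z) z := by
  have hε2 : (ε : ℂ) * ε = 1 := by rcases hε with rfl | rfl <;> norm_num
  have hlog : HasDerivAt (fun z => Real.log (z / 2)) (1 / z) z := by
    refine (((hasDerivAt_id z).div_const 2).log (by simpa using hz.ne')).congr_deriv ?_
    simp only [id]
    field_simp
  have hV := (((hasDerivAt_sinhLaplace_one hz).add hlog).add_const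
    Real.eulerMascheroniConstant).ofReal_comp
  refine ((((((hasDerivAt_cosOsc_const_mul 0 ε z).sub_const ((Real.pi / 2 : ℝ) : ℂ)).const_mul
    (ε * Complex.I)).add hV).const_mul ((1 / (2 * Real.pi) : ℝ) : ℂ))).congr_deriv ?_
  rw [radialError', sub_add_cancel, zero_add]
  congr 2
  linear_combination (Complex.I * Complex.I * cosOsc 1 (ε * z)) * hε2 +
    cosOsc 1 (ε * z) * Complex.I_mul_I

theorem abs_exp_neg_le_one {s : ℝ} (hs : 0 ≤ s) : |Real.exp (-s)| ≤ 1 := by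
  rw [abs_of_pos (Real.exp_pos _)]
  simpa using hs

theorem abs_exp_neg_mul_sinh_le_one {s : ℝ} (hs : 0 ≤ s) :
    |Real.exp (-s) * Real.sinh s| ≤ 1 := by
  have h0 := Real.sinh_nonneg_iff.2 hs
  rw [abs_of_nonneg (by positivity), Real.exp_neg, inv_mul_le_iff₀ (Real.exp_pos s), mul_one,
    ← Real.cosh_add_sinh]
  linarith [Real.cosh_pos s]

theorem hasDerivAt_radialError' (ε : ℝ) {z : ℝ} (hz : 0 < z) :
    HasDerivAt (radialError' ε) (radialError'' ε z) z := by
  have hV := (hasDerivAt_sinhLaplace (g := fun s => Real.exp (-s)) (by fun_prop)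
    (fun s => abs_exp_neg_le_one) hz).ofReal_comp
  refine ((((hasDerivAt_cosOsc_const_mul 1 ε z).neg).add hV).const_mul
    ((1 / (2 * Real.pi) : ℝ) : ℂ)).congr_deriv ?_
  rw [radialError'']
  push_cast
  ring

theorem norm_ofReal_one_div_two_pi_mul_le (a : ℂ) :
    ‖((1 / (2 * Real.pi) : ℝ) : ℂ) * a‖ ≤ ‖a‖ := by
  rw [norm_mul, Complex.norm_real, Real.norm_of_nonneg (by positivity)]
  refine mul_le_of_le_one_left (norm_nonneg _) ?_
  rw [div_le_one (by positivity)]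
  linarith [Real.pi_gt_three]

theorem norm_radialError_le {ε : ℝ} (hε : |ε| = 1) {z : ℝ} (hz : 0 < z) :
    ‖radialError ε z‖ ≤ (9 + 2 * √Real.pi) * z ^ ((1:ℝ) / 2) := by
  have h1 := norm_cosOsc_zero_sub_le (ε * z)
  have h2 := abs_sinhLaplace_one_add_log_le hz
  rw [abs_mul, hε, one_mul, abs_of_pos hz] at h1
  refine (norm_ofReal_one_div_two_pi_mul_le _).trans ((norm_add_le _ _).trans ?_)
  rw [norm_mul, norm_mul, Complex.norm_I, Complex.norm_real, Complex.norm_real, Real.norm_eq_abs,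
    hε, one_mul, one_mul, Real.norm_eq_abs]
  have : 0 ≤ z ^ ((1:ℝ) / 2) := by positivity
  linarith

theorem norm_radialError'_le {ε : ℝ} (hε : |ε| = 1) {z : ℝ} (hz : 0 < z) :
    ‖radialError' ε z‖ ≤ (9 + 2 * √Real.pi) * z ^ (-(1:ℝ) / 2) := by
  have hε0 : ε ≠ 0 := by rintro rfl; simp at hε
  have h1 := norm_cosOsc_succ_le 0 (mul_ne_zero hε0 hz.ne')
  have h2 := abs_sinhLaplace_le (g := fun s => Real.exp (-s)) (fun s => abs_exp_neg_le_one) hz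
  have h3 : √(Real.pi / 2) ≤ √Real.pi := Real.sqrt_le_sqrt (by linarith [Real.pi_pos])
  rw [abs_mul, hε, one_mul, abs_of_pos hz] at h1
  refine (norm_ofReal_one_div_two_pi_mul_le _).trans ((norm_add_le _ _).trans ?_)
  rw [norm_neg, Complex.norm_real, Real.norm_eq_abs]
  refine (add_le_add h1 h2).trans ?_
  rw [← add_mul]
  refine mul_le_mul_of_nonneg_right ?_ (by positivity)
  push_cast
  linarith [Real.sqrt_nonneg Real.pi]

theorem norm_radialError''_le {ε : ℝ} (hε : |ε| = 1) {z : ℝ} (hz : 0 < z) :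
    ‖radialError'' ε z‖ ≤ (9 + 2 * √Real.pi) * z ^ (-(1:ℝ) / 2) := by
  have hε0 : ε ≠ 0 := by rintro rfl; simp at hε
  have h1 := norm_cosOsc_succ_le 1 (mul_ne_zero hε0 hz.ne')
  have h2 := abs_sinhLaplace_le (g := fun s => Real.exp (-s) * Real.sinh s)
    (fun s => abs_exp_neg_mul_sinh_le_one) hz
  have h3 : √(Real.pi / 2) ≤ √Real.pi := Real.sqrt_le_sqrt (by linarith [Real.pi_pos])
  rw [abs_mul, hε, one_mul, abs_of_pos hz] at h1
  refine (norm_ofReal_one_div_two_pi_mul_le _).trans ((norm_sub_le _ _).trans ?_)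
  rw [norm_neg, norm_mul, norm_mul, Complex.norm_I, Complex.norm_real, Complex.norm_real,
    Real.norm_eq_abs, hε, one_mul, one_mul, Real.norm_eq_abs]
  refine (add_le_add h1 h2).trans ?_
  rw [← add_mul]
  refine mul_le_mul_of_nonneg_right ?_ (by positivity)
  push_cast
  linarith [Real.sqrt_nonneg Real.pi]

theorem hasDerivAt_E0 {ε : ℝ} (hε : ε = 1 ∨ ε = -1) {l : ℝ} (hl : 0 < l) {x y : Plane}
    (hxy : x ≠ y) : HasDerivAt (fun s => E0 ε s x y)
      (‖x - y‖ * radialError' ε (l * ‖x - y‖)) l := by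
  have hr : 0 < ‖x - y‖ := norm_pos_iff.2 (sub_ne_zero.2 hxy)
  have h : HasDerivAt (fun s => radialError ε (s * ‖x - y‖))
      (‖x - y‖ * radialError' ε (l * ‖x - y‖)) l := by
    have hm : HasDerivAt (fun s => s * ‖x - y‖) ‖x - y‖ l := hasDerivAt_mul_const _
    exact HasDerivAt.scomp (g₁ := radialError ε) l (hasDerivAt_radialError hε (mul_pos hl hr)) hm
  refine h.congr_of_eventuallyEq ?_
  filter_upwards [Ioi_mem_nhds hl] with s hs using E0_eq_radialError hε hs hxy

theorem iteratedDeriv_two_E0 {ε : ℝ} (hε : ε = 1 ∨ ε = -1) {l : ℝ} (hl : 0 < l) {x y : Plane}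
    (hxy : x ≠ y) : iteratedDeriv 2 (fun s => E0 ε s x y) l =
      ‖x - y‖ * (‖x - y‖ * radialError'' ε (l * ‖x - y‖)) := by
  have hr : 0 < ‖x - y‖ := norm_pos_iff.2 (sub_ne_zero.2 hxy)
  have h : HasDerivAt (fun s => radialError' ε (s * ‖x - y‖))
      (‖x - y‖ * radialError'' ε (l * ‖x - y‖)) l := by
    have hm : HasDerivAt (fun s => s * ‖x - y‖) ‖x - y‖ l := hasDerivAt_mul_const _
    exact HasDerivAt.scomp (g₁ := radialError' ε) l (hasDerivAt_radialError' ε (mul_pos hl hr)) hm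
  rw [iteratedDeriv_succ, iteratedDeriv_one]
  refine ((h.const_mul (‖x - y‖ : ℂ)).congr_of_eventuallyEq ?_).deriv
  filter_upwards [Ioi_mem_nhds hl] with s hs using (hasDerivAt_E0 hε hs hxy).deriv

/-- Bounds on the error term of the free resolvent expansion:
`|E₀^±| ≲ λ^{1/2}|x−y|^{1/2}`, `|∂_λ E₀^±| ≲ λ^{-1/2}|x−y|^{1/2}`,
`|∂_λ² E₀^±| ≲ λ^{-1/2}|x−y|^{3/2}`. -/
theorem free_resolvent_error_bounds :
    ∃ C : ℝ, 0 < C ∧ ∀ ε : ℝ, (ε = 1 ∨ ε = -1) →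
      ∀ l : ℝ, 0 < l → ∀ x y : Plane, x ≠ y →
        ‖E0 ε l x y‖ ≤ C * l ^ ((1:ℝ)/2) * ‖x - y‖ ^ ((1:ℝ)/2) ∧
        ‖deriv (fun s : ℝ => E0 ε s x y) l‖ ≤ C * l ^ (-(1:ℝ)/2) * ‖x - y‖ ^ ((1:ℝ)/2) ∧
        ‖iteratedDeriv 2 (fun s : ℝ => E0 ε s x y) l‖ ≤
          C * l ^ (-(1:ℝ)/2) * ‖x - y‖ ^ ((3:ℝ)/2) := by
  refine ⟨9 + 2 * √Real.pi, by positivity, fun ε hε l hl x y hxy => ?_⟩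
  have hr : 0 < ‖x - y‖ := norm_pos_iff.2 (sub_ne_zero.2 hxy)
  have hz := mul_pos hl hr
  have hε1 : |ε| = 1 := by rcases hε with rfl | rfl <;> simp
  have hpow1 : ‖x - y‖ * ‖x - y‖ ^ (-(1:ℝ) / 2) = ‖x - y‖ ^ ((1:ℝ) / 2) := by
    rw [mul_comm, ← Real.rpow_add_one hr.ne']
    norm_num
  have hpow2 : ‖x - y‖ * ‖x - y‖ ^ ((1:ℝ) / 2) = ‖x - y‖ ^ ((3:ℝ) / 2) := by
    rw [mul_comm, ← Real.rpow_add_one hr.ne']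
    norm_num
  have hnorm : ‖((‖x - y‖ : ℝ) : ℂ)‖ = ‖x - y‖ := by simp
  refine ⟨?_, ?_, ?_⟩
  · rw [E0_eq_radialError hε hl hxy]
    refine (norm_radialError_le hε1 hz).trans (le_of_eq ?_)
    rw [Real.mul_rpow hl.le hr.le, mul_assoc]
  · rw [(hasDerivAt_E0 hε hl hxy).deriv, norm_mul, hnorm]
    refine (mul_le_mul_of_nonneg_left (norm_radialError'_le hε1 hz) hr.le).trans (le_of_eq ?_)
    rw [Real.mul_rpow hl.le hr.le, ← hpow1]
    ring
  · rw [iteratedDeriv_two_E0 hε hl hxy, norm_mul, norm_mul, hnorm]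
    refine (mul_le_mul_of_nonneg_left (mul_le_mul_of_nonneg_left
      (norm_radialError''_le hε1 hz) hr.le) hr.le).trans (le_of_eq ?_)
    rw [Real.mul_rpow hl.le hr.le, ← hpow2, ← hpow1]
    ring
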